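/- arXiv:2004.10284 — 8 statements merged into one kernel-verified Lean document; each statement's English description precedes it below -/
import Mathlib

section
/- Let R > 0, let α : ℝ → ℝ be twice differentiable, and define the unit-speed plane curve c : ℝ → ℝ² by c(s) = ∫₀ˢ (cos α(σ), sin α(σ)) dσ. Then the space curve γ = F ∘ c is unit speed and its curvature satisfies ‖γ''(s)‖² = sin⁴(α(s))/R² + (α'(s))² for all s. -/
open scoped RealInnerProductSpace

/-- The rolling map `F : ℝ² → ℝ³`, `F(x,y) = (x, R·cos(y/R), R·sin(y/R))`. -/
noncomputable def rollMap (R : ℝ) (p : EuclideanSpace ℝ (Fin 2)) :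
    EuclideanSpace ℝ (Fin 3) :=
  (WithLp.equiv 2 (Fin 3 → ℝ)).symm
    ![p 0, R * Real.cos (p 1 / R), R * Real.sin (p 1 / R)]

/-- Coordinatewise differentiation of a curve in a Euclidean space. -/
theorem hasDerivAt_toLp {n : ℕ} {f : ℝ → Fin n → ℝ} {f' : Fin n → ℝ} {s : ℝ}
    (h : ∀ i, HasDerivAt (fun t => f t i) (f' i) s) :
    HasDerivAt (fun t => WithLp.toLp 2 (f t) : ℝ → EuclideanSpace ℝ (Fin n))
      (WithLp.toLp 2 f') s :=
  (EuclideanSpace.equiv (Fin n) ℝ).symm.hasFDerivAt.comp_hasDerivAt s (hasDerivAt_pi.2 h)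

/-- The Euclidean plane curve with continuous tangent angle `α` has velocity
`(cos α, sin α)`. -/
theorem hasDerivAt_integral_tangent {α : ℝ → ℝ} (hα : Continuous α) (s : ℝ) :
    HasDerivAt (fun s => ∫ σ in (0:ℝ)..s,
      (WithLp.toLp 2 ![Real.cos (α σ), Real.sin (α σ)] : EuclideanSpace ℝ (Fin 2)))
      (WithLp.toLp 2 ![Real.cos (α s), Real.sin (α s)]) s := by
  have hcont : Continuous fun σ =>
      (WithLp.toLp 2 ![Real.cos (α σ), Real.sin (α σ)] : EuclideanSpace ℝ (Fin 2)) := by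
    refine (PiLp.continuous_toLp 2 _).comp (continuous_pi fun i => ?_)
    fin_cases i <;> simp <;> fun_prop
  exact intervalIntegral.integral_hasDerivAt_right (hcont.intervalIntegrable _ _)
    (hcont.stronglyMeasurableAtFilter _ _) hcont.continuousAt

/-- For a twice differentiable tangent-angle function `α`, the plane curve
`c(s) = ∫₀ˢ (cos α(σ), sin α(σ)) dσ` rolled onto the cylinder of radius `R`
gives a unit speed space curve `γ = F ∘ c` whose squared curvature is
`‖γ''(s)‖² = sin⁴(α(s))/R² + (α'(s))²`. -/
theorem curvature_on_cylinder (R : ℝ) (hR : 0 < R) (α : ℝ → ℝ)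
    (hα : Differentiable ℝ α) (hα' : Differentiable ℝ (deriv α))
    (c : ℝ → EuclideanSpace ℝ (Fin 2))
    (hc : ∀ s : ℝ, c s = ∫ σ in (0:ℝ)..s,
      (WithLp.equiv 2 (Fin 2 → ℝ)).symm ![Real.cos (α σ), Real.sin (α σ)]) :
    (∀ s : ℝ, ‖deriv (rollMap R ∘ c) s‖ = 1) ∧
    (∀ s : ℝ, ‖deriv (deriv (rollMap R ∘ c)) s‖ ^ 2 =
      Real.sin (α s) ^ 4 / R ^ 2 + (deriv α s) ^ 2) := by
  have hc' (s : ℝ) :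
      HasDerivAt c (WithLp.toLp 2 ![Real.cos (α s), Real.sin (α s)]) s := by
    rw [funext hc]
    exact hasDerivAt_integral_tangent hα.continuous s
  have hcoord (i : Fin 2) (s : ℝ) :
      HasDerivAt (fun t => c t i) (![Real.cos (α s), Real.sin (α s)] i) s :=
    (EuclideanSpace.proj (𝕜 := ℝ) i).hasFDerivAt.comp_hasDerivAt s (hc' s)
  have hx (s : ℝ) : HasDerivAt (fun t => c t 0) (Real.cos (α s)) s := hcoord 0 s
  have hy (s : ℝ) : HasDerivAt (fun t => c t 1 / R) (Real.sin (α s) / R) s :=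
    (hcoord 1 s).div_const R
  have hγ (s : ℝ) : HasDerivAt (rollMap R ∘ c)
      (WithLp.toLp 2 ![Real.cos (α s), -Real.sin (c s 1 / R) * Real.sin (α s),
        Real.cos (c s 1 / R) * Real.sin (α s)]) s := by
    refine hasDerivAt_toLp fun i => ?_
    fin_cases i
    · exact hx s
    · refine ((hy s).cos.const_mul R).congr_deriv ?_
      simp
      field_simp
    · refine ((hy s).sin.const_mul R).congr_deriv ?_
      simp
      field_simp
  have hγ' (s : ℝ) : HasDerivAt (deriv (rollMap R ∘ c))
      (WithLp.toLp 2 ![-Real.sin (α s) * deriv α s,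
        -(Real.cos (c s 1 / R) * (Real.sin (α s) / R)) * Real.sin (α s) +
          -Real.sin (c s 1 / R) * (Real.cos (α s) * deriv α s),
        -Real.sin (c s 1 / R) * (Real.sin (α s) / R) * Real.sin (α s) +
          Real.cos (c s 1 / R) * (Real.cos (α s) * deriv α s)]) s := by
    rw [funext fun t => (hγ t).deriv]
    have ha := (hα s).hasDerivAt
    refine hasDerivAt_toLp fun i => ?_
    fin_cases i
    · exact ha.cos
    · exact (hy s).sin.neg.mul ha.sin
    · exact (hy s).cos.mul ha.sin
  refine ⟨fun s => ?_, fun s => ?_⟩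
  · have h1 := Real.sin_sq_add_cos_sq (α s)
    have h2 := Real.sin_sq_add_cos_sq (c s 1 / R)
    rw [(hγ s).deriv, ← sq_eq_sq₀ (norm_nonneg _) zero_le_one, EuclideanSpace.real_norm_sq_eq]
    simp [Fin.sum_univ_three]
    linear_combination h1 + Real.sin (α s) ^ 2 * h2
  · have h1 := Real.sin_sq_add_cos_sq (α s)
    have h2 := Real.sin_sq_add_cos_sq (c s 1 / R)
    rw [(hγ' s).deriv, EuclideanSpace.real_norm_sq_eq]
    simp [Fin.sum_univ_three]
    linear_combination (deriv α s) ^ 2 * h1 +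
      (Real.sin (α s) ^ 4 / R ^ 2 + Real.cos (α s) ^ 2 * (deriv α s) ^ 2) * h2
end

section
/- Let R > 0, κ > 1/R, and let α : ℝ → ℝ be differentiable with α(0) = 0 and α'(s) = √(κ² − sin⁴(α(s))/R²) for all s; let s₀ > 0 satisfy α(s₀) = π/2. Then the solution has the reflection symmetries α(−s) = −α(s) and α(2s₀ − s) = π − α(s) for all s ∈ ℝ. -/
open NNReal in
/-- If `g` is Lipschitz and symmetric about `α t₀`, then a global solution of `α' = g ∘ α`
is symmetric under the point reflection in `(t₀, α t₀)`. -/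
theorem ODE_solution_reflection {g α : ℝ → ℝ} {K : ℝ≥0} {t₀ : ℝ} (hg : LipschitzWith K g)
    (hα : ∀ t, HasDerivAt α (g (α t)) t) (hsymm : ∀ x, g (2 * α t₀ - x) = g x) (t : ℝ) :
    α (2 * t₀ - t) = 2 * α t₀ - α t := by
  have hβ : ∀ t, HasDerivAt (fun u => 2 * α t₀ - α (2 * t₀ - u))
      (g (2 * α t₀ - α (2 * t₀ - t))) t := fun t => by
    have h := ((hα (2 * t₀ - t)).comp_const_sub (2 * t₀) t).const_sub (2 * α t₀)
    rwa [neg_neg, ← hsymm] at h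
  have heq : α = fun u => 2 * α t₀ - α (2 * t₀ - u) :=
    ODE_solution_unique_univ (v := fun _ => g) (s := fun _ => Set.univ) (K := K) (t₀ := t₀)
      (fun _ => hg.lipschitzOnWith) (fun t => ⟨hα t, Set.mem_univ _⟩)
      (fun t => ⟨hβ t, Set.mem_univ _⟩) (by ring_nf)
  have h := congrFun heq t
  linarith

open Real in
/-- The function `x ↦ √(a - sin⁴ x / b)` is Lipschitz when its radicand is bounded away from `0`. -/
theorem exists_lipschitzWith_sqrt_sub_sin_pow_four_div {a b : ℝ} (hb : 0 < b) (hab : 1 / b < a) :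
    ∃ K, LipschitzWith K fun x => √(a - sin x ^ 4 / b) := by
  have hm : 0 < a - 1 / b := sub_pos.2 hab
  have hle : ∀ x, a - 1 / b ≤ a - sin x ^ 4 / b := fun x => by
    have : sin x ^ 4 ≤ 1 := by
      rw [← (by decide : Even 4).pow_abs]
      exact pow_le_one₀ (abs_nonneg _) (abs_sin_le_one x)
    gcongr
  have hd : ∀ x, HasDerivAt (fun x => √(a - sin x ^ 4 / b))
      (-(4 * sin x ^ 3 * cos x / b) / (2 * √(a - sin x ^ 4 / b))) x := fun x => by
    have h := ((((hasDerivAt_sin x).pow 4).div_const b).const_sub a).sqrt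
      (hm.trans_le (hle x)).ne'
    simpa using! h
  refine ⟨NNReal.mk ((4 / b) / (2 * √(a - 1 / b))) (by positivity),
    lipschitzWith_of_nnnorm_deriv_le (fun x => (hd x).differentiableAt) fun x => ?_⟩
  rw [(hd x).deriv, ← NNReal.coe_le_coe, coe_nnnorm, NNReal.coe_mk, norm_div, norm_neg,
    norm_eq_abs, norm_eq_abs, abs_of_nonneg (by positivity : 0 ≤ 2 * √(a - sin x ^ 4 / b))]
  have hnum : |4 * sin x ^ 3 * cos x / b| ≤ 4 / b := by
    rw [abs_div, abs_of_pos hb, abs_mul, abs_mul, abs_pow, mul_assoc]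
    gcongr
    have h3 : |sin x| ^ 3 * |cos x| ≤ 1 :=
      mul_le_one₀ (pow_le_one₀ (abs_nonneg _) (abs_sin_le_one x)) (abs_nonneg _)
        (abs_cos_le_one x)
    rw [abs_of_pos (by norm_num : (0 : ℝ) < 4)]
    linarith
  have hpos : 0 < √(a - 1 / b) := sqrt_pos.2 hm
  exact div_le_div₀ (by positivity) hnum (by positivity)
    (mul_le_mul_of_nonneg_left (sqrt_le_sqrt (hle x)) zero_le_two)


/-- For `R > 0`, `κ > 1/R`, a solution `α` of the ODE
`α'(s) = √(κ² − sin⁴(α(s))/R²)` with `α(0) = 0` and `α(s₀) = π/2` for some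
`s₀ > 0` enjoys the reflection symmetries `α(−s) = −α(s)` and
`α(2s₀ − s) = π − α(s)`. -/
theorem reflection_symmetries (R κ : ℝ) (hR : 0 < R) (hκ : 1 / R < κ)
    (α : ℝ → ℝ) (hα : Differentiable ℝ α) (h0 : α 0 = 0)
    (hode : ∀ s : ℝ, deriv α s = Real.sqrt (κ ^ 2 - Real.sin (α s) ^ 4 / R ^ 2))
    (s₀ : ℝ) (hs₀ : 0 < s₀) (hαs₀ : α s₀ = Real.pi / 2) :
    (∀ s : ℝ, α (-s) = -α s) ∧
    (∀ s : ℝ, α (2 * s₀ - s) = Real.pi - α s) := by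
  obtain ⟨K, hK⟩ := exists_lipschitzWith_sqrt_sub_sin_pow_four_div (a := κ ^ 2) (b := R ^ 2)
    (by positivity) (by
      rw [← one_div_pow]
      exact pow_lt_pow_left₀ hκ (by positivity) two_ne_zero)
  have hd : ∀ s, HasDerivAt α (Real.sqrt (κ ^ 2 - Real.sin (α s) ^ 4 / R ^ 2)) s := fun s =>
    hode s ▸ (hα s).hasDerivAt
  refine ⟨fun s => ?_, fun s => ?_⟩
  · simpa [h0] using ODE_solution_reflection (t₀ := 0) hK hd
      (fun x => by simp [h0, (by decide : Even 4).neg_pow]) s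
  · have hπ : 2 * α s₀ = Real.pi := by rw [hαs₀]; ring
    rw [← hπ]
    exact ODE_solution_reflection hK hd (fun x => by simp only [hπ, Real.sin_pi_sub]) s
end

section
/- Let R > 0, κ > 1/R, let α : ℝ → ℝ be differentiable with α(0) = 0 and α'(s) = √(κ² − sin⁴(α(s))/R²) for all s, let s₀ > 0 satisfy α(s₀) = π/2, and define c : ℝ → ℝ² by c(s) = ∫₀ˢ (cos α(σ), sin α(σ)) dσ. Then α(s + 4s₀) = α(s) + 2π and c(s + 4s₀) = c(s) for all s; hence c is a closed convex plane curve and F ∘ c is a closed space curve of constant curvature κ on the cylinder of radius R. -/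
/-- Separation of variables for the autonomous equation `α' = f(α)` with `f > 0`. -/
theorem integral_inv_comp_of_hasDerivAt {f α : ℝ → ℝ} (hf : Continuous f) (hpos : ∀ a, 0 < f a)
    (hα : ∀ s, HasDerivAt α (f (α s)) s) (a b : ℝ) :
    ∫ t in α a..α b, (f t)⁻¹ = b - a := by
  have hg : Continuous fun t => (f t)⁻¹ := hf.inv₀ fun t => (hpos t).ne'
  have hd : ∀ s, HasDerivAt (fun s => (∫ t in α a..α s, (f t)⁻¹) - s) 0 s := by
    intro s
    have h1 := (intervalIntegral.integral_hasDerivAt_right (hg.intervalIntegrable (α a) (α s))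
      (hg.stronglyMeasurableAtFilter _ _) hg.continuousAt).comp s (hα s)
    have h2 := h1.sub (hasDerivAt_id s)
    rwa [inv_mul_cancel₀ (hpos _).ne', sub_self] at h2
  have h := is_const_of_deriv_eq_zero (fun s => (hd s).differentiableAt) (fun s => (hd s).deriv) b a
  simp only [intervalIntegral.integral_same] at h
  linarith

/-- If `f > 0` is even and `T`-periodic, a solution of `α' = f(α)` that runs from `0` to `T / 2` in
time `s₀` advances by `T` in every time interval of length `2 * s₀`. -/
theorem add_period_of_hasDerivAt {f α : ℝ → ℝ} {T s₀ : ℝ} (hf : Continuous f)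
    (hpos : ∀ a, 0 < f a) (heven : ∀ a, f (-a) = f a) (hper : Function.Periodic f T)
    (hα : ∀ s, HasDerivAt α (f (α s)) s) (h0 : α 0 = 0) (hs₀ : α s₀ = T / 2) (s : ℝ) :
    α (s + 2 * s₀) = α s + T := by
  have hg : Continuous fun t => (f t)⁻¹ := hf.inv₀ fun t => (hpos t).ne'
  have hi : ∀ a b, IntervalIntegrable (fun t => (f t)⁻¹) MeasureTheory.volume a b :=
    fun a b => hg.intervalIntegrable a b
  have hmono : StrictMono fun x => ∫ t in (0 : ℝ)..x, (f t)⁻¹ := by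
    refine strictMono_of_deriv_pos fun x => ?_
    rw [hg.deriv_integral]
    exact inv_pos.2 (hpos x)
  have hhalf : ∫ t in (0 : ℝ)..T / 2, (f t)⁻¹ = s₀ := by
    have h := integral_inv_comp_of_hasDerivAt hf hpos hα 0 s₀
    rwa [h0, hs₀, sub_zero] at h
  have hneg : ∫ t in -(T / 2)..0, (f t)⁻¹ = s₀ := by
    have h := intervalIntegral.integral_comp_neg (a := 0) (b := T / 2) fun t => (f t)⁻¹
    simp only [heven, neg_zero] at h
    rw [← h, hhalf]
  have hperiod : ∫ t in α s..α s + T, (f t)⁻¹ = 2 * s₀ := by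
    have hp : Function.Periodic (fun t => (f t)⁻¹) T := fun t => by simp only [hper t]
    rw [hp.intervalIntegral_add_eq (α s) (-(T / 2)), show -(T / 2) + T = T / 2 by ring,
      ← intervalIntegral.integral_add_adjacent_intervals (hi _ 0) (hi 0 _), hhalf, hneg]
    ring
  apply hmono.injective
  have h1 := intervalIntegral.integral_add_adjacent_intervals (hi 0 (α s)) (hi _ (α s + T))
  have h2 := intervalIntegral.integral_add_adjacent_intervals (hi 0 (α s)) (hi _ (α (s + 2 * s₀)))
  have h3 := integral_inv_comp_of_hasDerivAt hf hpos hα s (s + 2 * s₀)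
  simp only
  linarith

/-- A primitive of a continuous `T`-antiperiodic function is `2T`-periodic. -/
theorem Function.Antiperiodic.integral_add_two_mul {E : Type*} [NormedAddCommGroup E]
    [NormedSpace ℝ E] {v : ℝ → E} {T : ℝ} (hv : Continuous v) (h : Function.Antiperiodic v T)
    (a s : ℝ) : ∫ t in a..s + 2 * T, v t = ∫ t in a..s, v t := by
  have hi : ∀ a b, IntervalIntegrable v MeasureTheory.volume a b :=
    fun a b => hv.intervalIntegrable a b
  have hshift : ∫ t in s + T..s + 2 * T, v t = -∫ t in s..s + T, v t := by
    rw [show s + 2 * T = s + T + T by ring, ← intervalIntegral.integral_comp_add_right,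
      ← intervalIntegral.integral_neg]
    simp only [h _]
  rw [← intervalIntegral.integral_add_adjacent_intervals (hi a s) (hi s (s + 2 * T)),
    ← intervalIntegral.integral_add_adjacent_intervals (hi s (s + T)) (hi (s + T) (s + 2 * T)),
    hshift, add_neg_cancel, add_zero]

theorem hasDerivAt_euclidean {ι : Type*} [Fintype ι] {f : ℝ → EuclideanSpace ℝ ι}
    {f' : EuclideanSpace ℝ ι} {x : ℝ} :
    HasDerivAt f f' x ↔ ∀ i, HasDerivAt (fun x => f x i) (f' i) x := by
  simp only [hasDerivAt_iff_hasFDerivAt, ← hasFDerivWithinAt_univ, hasFDerivWithinAt_euclidean]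
  refine forall_congr' fun i => iff_of_eq ?_
  congr 1

/-- The curvature of a rolled unit-speed plane curve with tangent angle `α`. -/
theorem norm_deriv_deriv_rollMap_comp {R : ℝ} (hR : R ≠ 0) {α α' : ℝ → ℝ}
    {c : ℝ → EuclideanSpace ℝ (Fin 2)} (hα : ∀ s, HasDerivAt α (α' s) s)
    (hc : ∀ s, HasDerivAt c
      ((WithLp.equiv 2 (Fin 2 → ℝ)).symm ![Real.cos (α s), Real.sin (α s)]) s) (s : ℝ) :
    ‖deriv (deriv (rollMap R ∘ c)) s‖ =
      Real.sqrt (α' s ^ 2 + Real.sin (α s) ^ 4 / R ^ 2) := by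
  have hx : ∀ s, HasDerivAt (fun s => c s 0) (Real.cos (α s)) s := fun s => by
    simpa using (hasDerivAt_euclidean.1 (hc s)) 0
  have hy : ∀ s, HasDerivAt (fun s => c s 1) (Real.sin (α s)) s := fun s => by
    simpa using (hasDerivAt_euclidean.1 (hc s)) 1
  have hfirst : deriv (rollMap R ∘ c) = fun s => (WithLp.equiv 2 (Fin 3 → ℝ)).symm
      ![Real.cos (α s), -(Real.sin (c s 1 / R) * Real.sin (α s)),
        Real.cos (c s 1 / R) * Real.sin (α s)] := by
    funext s
    refine HasDerivAt.deriv (hasDerivAt_euclidean.2 fun i => ?_)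
    fin_cases i
    · simpa [rollMap] using hx s
    · refine (((hy s).div_const R).cos.const_mul R).congr_deriv ?_
      simp
      field_simp
    · refine (((hy s).div_const R).sin.const_mul R).congr_deriv ?_
      simp
      field_simp
  have hsecond : HasDerivAt (deriv (rollMap R ∘ c)) ((WithLp.equiv 2 (Fin 3 → ℝ)).symm
      ![-Real.sin (α s) * α' s,
        -(Real.cos (c s 1 / R) * (Real.sin (α s) / R) * Real.sin (α s) +
          Real.sin (c s 1 / R) * (Real.cos (α s) * α' s)),
        -Real.sin (c s 1 / R) * (Real.sin (α s) / R) * Real.sin (α s) +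
          Real.cos (c s 1 / R) * (Real.cos (α s) * α' s)]) s := by
    rw [hfirst]
    refine hasDerivAt_euclidean.2 fun i => ?_
    fin_cases i
    · exact (hα s).cos
    · exact (((hy s).div_const R).sin.mul (hα s).sin).neg
    · exact ((hy s).div_const R).cos.mul (hα s).sin
  rw [hsecond.deriv, EuclideanSpace.norm_eq, Fin.sum_univ_three]
  congr 1
  simp only [Real.norm_eq_abs, sq_abs, WithLp.equiv_symm_apply, Matrix.cons_val]
  have h1 := Real.sin_sq_add_cos_sq (α s)
  have h2 := Real.sin_sq_add_cos_sq (c s 1 / R)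
  generalize Real.sin (α s) = a at *
  generalize Real.cos (α s) = b at *
  generalize Real.sin (c s 1 / R) = p at *
  generalize Real.cos (c s 1 / R) = q at *
  generalize α' s = k
  linear_combination (k ^ 2) * h1 + (a ^ 4 / R ^ 2 + b ^ 2 * k ^ 2) * h2

/-- For `R > 0`, `κ > 1/R`, a solution `α` of `α'(s) = √(κ² − sin⁴(α(s))/R²)`
with `α(0) = 0` and `α(s₀) = π/2`, the plane curve
`c(s) = ∫₀ˢ (cos α(σ), sin α(σ)) dσ` satisfies `α(s + 4s₀) = α(s) + 2π` and
`c(s + 4s₀) = c(s)`; hence `c` is a closed plane curve and `F ∘ c` is a closed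
space curve of constant curvature `κ` on the cylinder of radius `R`. -/
theorem closed_constant_curvature_on_cylinder (R κ : ℝ) (hR : 0 < R)
    (hκ : 1 / R < κ) (α : ℝ → ℝ) (hα : Differentiable ℝ α) (h0 : α 0 = 0)
    (hode : ∀ s : ℝ, deriv α s = Real.sqrt (κ ^ 2 - Real.sin (α s) ^ 4 / R ^ 2))
    (s₀ : ℝ) (hs₀ : 0 < s₀) (hαs₀ : α s₀ = Real.pi / 2)
    (c : ℝ → EuclideanSpace ℝ (Fin 2))
    (hc : ∀ s : ℝ, c s = ∫ σ in (0:ℝ)..s,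
      (WithLp.equiv 2 (Fin 2 → ℝ)).symm ![Real.cos (α σ), Real.sin (α σ)]) :
    (∀ s : ℝ, α (s + 4 * s₀) = α s + 2 * Real.pi) ∧
    (∀ s : ℝ, c (s + 4 * s₀) = c s) ∧
    (∀ s : ℝ, (rollMap R ∘ c) (s + 4 * s₀) = (rollMap R ∘ c) s) ∧
    (∀ s : ℝ, ‖deriv (deriv (rollMap R ∘ c)) s‖ = κ) := by
  have hκ0 : 0 < κ := (one_div_pos.2 hR).trans hκ
  have hrad : ∀ a : ℝ, 0 < κ ^ 2 - Real.sin a ^ 4 / R ^ 2 := by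
    intro a
    have h1 : (1 / R) ^ 2 < κ ^ 2 := pow_lt_pow_left₀ hκ (one_div_pos.2 hR).le two_ne_zero
    have h2 : Real.sin a ^ 4 / R ^ 2 ≤ (1 / R) ^ 2 := by
      rw [div_pow, one_pow]
      gcongr
      nlinarith [Real.sin_sq_le_one a, sq_nonneg (Real.sin a)]
    linarith
  have hder : ∀ s, HasDerivAt α (Real.sqrt (κ ^ 2 - Real.sin (α s) ^ 4 / R ^ 2)) s :=
    fun s => hode s ▸ (hα s).hasDerivAt
  have hhalf : ∀ s, α (s + 2 * s₀) = α s + Real.pi :=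
    add_period_of_hasDerivAt (f := fun a => Real.sqrt (κ ^ 2 - Real.sin a ^ 4 / R ^ 2))
      (by fun_prop) (fun a => Real.sqrt_pos.2 (hrad a))
      (fun a => by simp [(show Even 4 by decide).neg_pow])
      (fun a => by simp [(show Even 4 by decide).neg_pow]) hder h0 hαs₀
  have hfour : ∀ s : ℝ, s + 4 * s₀ = s + 2 * (2 * s₀) := fun s => by ring
  have hv : Continuous fun σ => (WithLp.equiv 2 (Fin 2 → ℝ)).symm
      ![Real.cos (α σ), Real.sin (α σ)] := by
    have := hα.continuous
    refine (PiLp.continuous_toLp 2 _).comp (continuous_pi fun i => ?_)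
    fin_cases i
    · exact Real.continuous_cos.comp this
    · exact Real.continuous_sin.comp this
  have hanti : Function.Antiperiodic (fun σ => (WithLp.equiv 2 (Fin 2 → ℝ)).symm
      ![Real.cos (α σ), Real.sin (α σ)]) (2 * s₀) := by
    intro σ
    ext i
    fin_cases i <;> simp [hhalf]
  have hclosed : ∀ s, c (s + 4 * s₀) = c s := fun s => by
    rw [hc, hc, hfour, hanti.integral_add_two_mul hv]
  refine ⟨fun s => ?_, hclosed, fun s => congrArg (rollMap R) (hclosed s), fun s => ?_⟩
  · rw [show s + 4 * s₀ = s + 2 * s₀ + 2 * s₀ by ring, hhalf, hhalf]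
    ring
  · have hcd : ∀ s, HasDerivAt c ((WithLp.equiv 2 (Fin 2 → ℝ)).symm
        ![Real.cos (α s), Real.sin (α s)]) s := by
      intro s
      rw [funext hc]
      exact hv.integral_hasStrictDerivAt 0 s |>.hasDerivAt
    rw [norm_deriv_deriv_rollMap_comp hR.ne' hder hcd, Real.sq_sqrt (hrad _).le, sub_add_cancel,
      Real.sqrt_sq hκ0.le]
end

section
/- Let R > 0, κ > 0, and let α : ℝ → ℝ be twice differentiable with α''(s) = −2·sin³(α(s))·cos(α(s))/R² for all s and (α'(0))² + sin⁴(α(0))/R² = κ². Then sin⁴(α(s)) ≤ κ²·R² for all s ∈ ℝ; in particular if κ < 1/R then sin²(α(s)) ≤ κ·R < 1 for all s, so the tangent angle stays bounded away from π/2 modulo π and the curve oscillates around a parallel to the x-axis. -/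
/-- The energy `(α')² + sin⁴(α)/R²` is constant along solutions of
`α'' = −2·sin³(α)·cos(α)/R²`. -/
theorem tangent_angle_energy_conserved (R : ℝ) (α : ℝ → ℝ)
    (hα : Differentiable ℝ α) (hα' : Differentiable ℝ (deriv α))
    (hode : ∀ s : ℝ, deriv (deriv α) s =
      -2 * Real.sin (α s) ^ 3 * Real.cos (α s) / R ^ 2) (s t : ℝ) :
    (deriv α s) ^ 2 + Real.sin (α s) ^ 4 / R ^ 2 =
      (deriv α t) ^ 2 + Real.sin (α t) ^ 4 / R ^ 2 := by
  have hderiv (x : ℝ) :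
      HasDerivAt (fun s ↦ (deriv α s) ^ 2 + Real.sin (α s) ^ 4 / R ^ 2) 0 x := by
    refine (((hα' x).hasDerivAt.pow 2).add
      (((hα x).hasDerivAt.sin.pow 4).div_const (R ^ 2))).congr_deriv ?_
    rw [hode]
    push_cast
    ring
  exact is_const_of_deriv_eq_zero (fun x ↦ (hderiv x).differentiableAt)
    (fun x ↦ (hderiv x).deriv) s t

/-- For a solution of `α'' = −2·sin³(α)·cos(α)/R²` with energy
`(α'(0))² + sin⁴(α(0))/R² = κ²` one has `sin⁴(α(s)) ≤ κ²R²` for all `s`;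
in particular if `κ < 1/R` then `sin²(α(s)) ≤ κR < 1` for all `s`, so the
tangent angle stays bounded away from `π/2` modulo `π`. -/
theorem tangent_angle_bounded (R κ : ℝ) (hR : 0 < R) (hκ : 0 < κ)
    (α : ℝ → ℝ) (hα : Differentiable ℝ α) (hα' : Differentiable ℝ (deriv α))
    (hode : ∀ s : ℝ, deriv (deriv α) s =
      -2 * Real.sin (α s) ^ 3 * Real.cos (α s) / R ^ 2)
    (henergy : (deriv α 0) ^ 2 + Real.sin (α 0) ^ 4 / R ^ 2 = κ ^ 2) :
    (∀ s : ℝ, Real.sin (α s) ^ 4 ≤ κ ^ 2 * R ^ 2) ∧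
    (κ < 1 / R → (∀ s : ℝ, Real.sin (α s) ^ 2 ≤ κ * R) ∧ κ * R < 1) := by
  have hbound (s : ℝ) : Real.sin (α s) ^ 4 ≤ κ ^ 2 * R ^ 2 := by
    have hs := tangent_angle_energy_conserved R α hα hα' hode s 0
    rw [← div_le_iff₀ (by positivity)]
    linarith [sq_nonneg (deriv α s)]
  refine ⟨hbound, fun hlt ↦ ⟨fun s ↦ ?_, (lt_div_iff₀ hR).mp hlt⟩⟩
  exact abs_le_of_sq_le_sq' (by linarith [hbound s]) (by positivity) |>.2
end

section
/- Let R > 0 and 0 < κ < 1/R, and let α : ℝ → ℝ be twice differentiable with α''(s) = −2·sin³(α(s))·cos(α(s))/R², α(0) = 0 and α'(0) = κ. Then there exists s* > 0 with α'(s*) = 0 and sin²(α(s*)) = κ·R; that is, the solution reaches the turning value α_max = arcsin(√(κR)) in finite time and α' changes sign there. -/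
/-- The energy `(α')² + sin⁴(α)/R²` is conserved along solutions of
`α'' = −2·sin³(α)·cos(α)/R²`. -/
theorem deriv_sq_add_sin_pow_four_eq {R : ℝ} {α : ℝ → ℝ} (hα : Differentiable ℝ α)
    (hα' : Differentiable ℝ (deriv α))
    (hode : ∀ s : ℝ, deriv (deriv α) s =
      -2 * Real.sin (α s) ^ 3 * Real.cos (α s) / R ^ 2) (s t : ℝ) :
    deriv α s ^ 2 + Real.sin (α s) ^ 4 / R ^ 2 =
      deriv α t ^ 2 + Real.sin (α t) ^ 4 / R ^ 2 := by
  have hE : ∀ x, HasDerivAt (fun s => deriv α s ^ 2 + Real.sin (α s) ^ 4 / R ^ 2) 0 x := by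
    intro x
    have h := ((hα' x).hasDerivAt.pow 2).add
      (((hα x).hasDerivAt.sin.pow 4).div_const (R ^ 2))
    refine h.congr_deriv ?_
    rw [hode x]
    push_cast
    ring
  exact is_const_of_deriv_eq_zero (fun x => (hE x).differentiableAt) (fun x => (hE x).deriv) s t

/-- For `0 < κ < 1/R`, the solution of `α'' = −2·sin³(α)·cos(α)/R²` with
`α(0) = 0` and `α'(0) = κ` reaches a turning point in finite time: there is
`s* > 0` with `α'(s*) = 0` and `sin²(α(s*)) = κR`. -/
theorem turning_point (R κ : ℝ) (hR : 0 < R) (hκ : 0 < κ) (hκR : κ < 1 / R)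
    (α : ℝ → ℝ) (hα : Differentiable ℝ α) (hα' : Differentiable ℝ (deriv α))
    (hode : ∀ s : ℝ, deriv (deriv α) s =
      -2 * Real.sin (α s) ^ 3 * Real.cos (α s) / R ^ 2)
    (h0 : α 0 = 0) (h0' : deriv α 0 = κ) :
    ∃ sstar : ℝ, 0 < sstar ∧ deriv α sstar = 0 ∧
      Real.sin (α sstar) ^ 2 = κ * R := by
  have hE : ∀ s, (deriv α s * R) ^ 2 + (Real.sin (α s) ^ 2) ^ 2 = (κ * R) ^ 2 := by
    intro s
    have h := deriv_sq_add_sin_pow_four_eq hα hα' hode s 0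
    rw [h0, h0', Real.sin_zero] at h
    field_simp at h
    linear_combination h
  have hκR0 : 0 < κ * R := mul_pos hκ hR
  have hκR1 : κ * R < 1 := (lt_div_iff₀ hR).mp hκR
  have hsin : ∀ s, Real.sin (α s) ^ 2 ≤ κ * R := fun s =>
    abs_le_of_sq_le_sq' (by nlinarith [hE s, sq_nonneg (deriv α s * R)]) hκR0.le |>.2
  suffices h : ∃ s, 0 < s ∧ deriv α s = 0 by
    obtain ⟨s, hs, hds⟩ := h
    refine ⟨s, hs, hds, ?_⟩
    have h := hE s
    rw [hds, zero_mul, zero_pow two_ne_zero, zero_add] at h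
    exact (sq_eq_sq₀ (sq_nonneg _) hκR0.le).mp h
  by_contra! hne
  have hpos : ∀ s, 0 ≤ s → 0 < deriv α s := by
    intro s hs
    by_contra! hle
    obtain ⟨t, ht, hdt⟩ := intermediate_value_Icc' hs hα'.continuous.continuousOn
      ⟨hle, h0' ▸ hκ.le⟩
    rcases ht.1.eq_or_lt with rfl | ht0
    · exact hκ.ne' (h0' ▸ hdt)
    · exact hne t ht0 hdt
  have hmono : StrictMonoOn α (Set.Ici 0) :=
    strictMonoOn_of_deriv_pos (convex_Ici 0) hα.continuous.continuousOn fun s hs =>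
      hpos s (interior_subset hs)
  have hlt : ∀ s, 0 ≤ s → α s < Real.pi / 2 := by
    intro s hs
    by_contra! hle
    obtain ⟨t, -, ht⟩ := intermediate_value_Icc hs hα.continuous.continuousOn
      ⟨h0.trans_le (by positivity), hle⟩
    have h := hsin t
    rw [ht, Real.sin_pi_div_two] at h
    linarith
  have ha : 0 < α 1 := h0 ▸ hmono (by simp) (by simp) one_pos
  have hsa : 0 < Real.sin (α 1) :=
    Real.sin_pos_of_pos_of_lt_pi ha (by linarith [hlt 1 zero_le_one, Real.pi_pos])
  set c : ℝ := 2 * Real.sin (α 1) ^ 3 * (1 - κ * R) / R ^ 2 with hc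
  have hc0 : 0 < c := by
    have : 0 < 1 - κ * R := sub_pos.mpr hκR1
    positivity
  have hdd : ∀ s, 1 ≤ s → deriv (deriv α) s ≤ -c := by
    intro s hs
    have hs0 : 0 ≤ s := zero_le_one.trans hs
    have hle : α 1 ≤ α s := hmono.monotoneOn (by simp) hs0 hs
    have hsin_le : Real.sin (α 1) ≤ Real.sin (α s) :=
      Real.sin_le_sin_of_le_of_le_pi_div_two (by linarith [Real.pi_pos]) (hlt s hs0).le hle
    have hcos0 : 0 ≤ Real.cos (α s) :=
      Real.cos_nonneg_of_neg_pi_div_two_le_of_le (by linarith [Real.pi_pos]) (hlt s hs0).le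
    have hcos : 1 - κ * R ≤ Real.cos (α s) := by
      nlinarith [hsin s, Real.sin_sq_add_cos_sq (α s), Real.cos_le_one (α s)]
    have hprod : Real.sin (α 1) ^ 3 * (1 - κ * R) ≤ Real.sin (α s) ^ 3 * Real.cos (α s) :=
      mul_le_mul (pow_le_pow_left₀ hsa.le hsin_le 3) hcos (sub_pos.mpr hκR1).le
        (pow_nonneg (hsa.le.trans hsin_le) 3)
    rw [hode s, hc, ← neg_div]
    gcongr
    linarith
  have hd1 : 0 < deriv α 1 := hpos 1 zero_le_one
  have hs : 1 < 1 + deriv α 1 / c := by linarith [div_pos hd1 hc0]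
  obtain ⟨ξ, hξ, hmvt⟩ := exists_deriv_eq_slope (deriv α) hs
    hα'.continuous.continuousOn hα'.differentiableOn
  have h := hdd ξ hξ.1.le
  rw [hmvt, add_sub_cancel_left, div_le_iff₀ (div_pos hd1 hc0), neg_mul,
    mul_div_cancel₀ _ hc0.ne'] at h
  linarith [hpos _ (zero_le_one.trans hs.le)]
end

section
/- Let R > 0, 0 < κ < 1/R, and set α₀ = arcsin(√(κR)). Then the equation (α'(s))² = κ² − sin⁴(α(s))/R² with initial value α(0) = α₀ does not have unique solutions: the constant function α ≡ α₀ is a solution, and there also exists a nonconstant continuously differentiable solution β : ℝ → ℝ with β(0) = α₀. -/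
/-- An autonomous scalar equation with continuous, positive and bounded right-hand side has a
global solution through every initial value, and that solution takes every real value. -/
theorem exists_surjective_hasDerivAt_of_pos_of_le {F : ℝ → ℝ} {M : ℝ} (hF : Continuous F)
    (hpos : ∀ x, 0 < F x) (hM : ∀ x, F x ≤ M) (a : ℝ) :
    ∃ φ : ℝ → ℝ, φ 0 = a ∧ (∀ t, HasDerivAt φ (F (φ t)) t) ∧ Function.Surjective φ := by
  have hM0 : 0 < M := (hpos 0).trans_le (hM 0)
  have hFinv : Continuous fun x => (F x)⁻¹ := hF.inv₀ fun x => (hpos x).ne'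
  set G : ℝ → ℝ := fun x => ∫ u in a..x, (F u)⁻¹
  have hG : ∀ x, HasDerivAt G (F x)⁻¹ x := fun x =>
    intervalIntegral.integral_hasDerivAt_right (hFinv.intervalIntegrable _ _)
      (hFinv.stronglyMeasurableAtFilter _ _) hFinv.continuousAt
  have hGa : G a = 0 := intervalIntegral.integral_same
  have hmono : StrictMono G := strictMono_of_deriv_pos fun x => by
    rw [(hG x).deriv]
    exact inv_pos.2 (hpos x)
  have hGcont : Continuous G := continuous_iff_continuousAt.2 fun x => (hG x).continuousAt
  have hlin : Monotone fun x => G x - M⁻¹ * x := by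
    have hd : ∀ x, HasDerivAt (fun x => G x - M⁻¹ * x) ((F x)⁻¹ - M⁻¹ * 1) x := fun x =>
      (hG x).sub ((hasDerivAt_id x).const_mul _)
    refine monotone_of_deriv_nonneg (fun x => (hd x).differentiableAt) fun x => ?_
    rw [(hd x).deriv, mul_one, sub_nonneg]
    exact inv_anti₀ (hpos x) (hM x)
  have hsurj : Function.Surjective G := by
    refine hGcont.surjective ?_ ?_
    · refine Filter.tendsto_atTop_mono' _ (f₁ := fun x => M⁻¹ * x + (G a - M⁻¹ * a)) ?_
        (Filter.tendsto_atTop_add_const_right _ _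
          (Filter.tendsto_id.const_mul_atTop (inv_pos.2 hM0)))
      filter_upwards [Filter.eventually_ge_atTop a] with x hx
      have := hlin hx
      dsimp only at this
      linarith
    · refine Filter.tendsto_atBot_mono' _ (f₁ := fun x => M⁻¹ * x + (G a - M⁻¹ * a)) ?_
        (Filter.tendsto_atBot_add_const_right _ _
          (Filter.tendsto_id.const_mul_atBot (inv_pos.2 hM0)))
      filter_upwards [Filter.eventually_le_atBot a] with x hx
      have := hlin hx
      dsimp only at this
      linarith
  set e : ℝ ≃o ℝ := hmono.orderIsoOfSurjective G hsurj
  have he : ∀ x, e x = G x := fun _ => rfl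
  refine ⟨e.symm, ?_, fun t => ?_, e.symm.surjective⟩
  · rw [OrderIso.symm_apply_eq, he, hGa]
  · have h := (hG (e.symm t)).of_local_left_inverse e.symm.continuous.continuousAt
      (inv_ne_zero (hpos _).ne') (Filter.Eventually.of_forall fun y => e.apply_symm_apply y)
    rwa [inv_inv] at h

/-- For `0 < κ < 1/R` the squared first-order equation
`(α')² = κ² − sin⁴(α)/R²` with initial value `α₀ = arcsin(√(κR))` does not
have unique solutions: the constant function `α ≡ α₀` is a solution, and there
is also a nonconstant continuously differentiable solution `β` with
`β(0) = α₀`. -/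
theorem non_uniqueness (R κ : ℝ) (hR : 0 < R) (hκ : 0 < κ) (hκR : κ < 1 / R) :
    (∀ s : ℝ, (deriv (fun _ : ℝ => Real.arcsin (Real.sqrt (κ * R))) s) ^ 2 =
      κ ^ 2 - Real.sin (Real.arcsin (Real.sqrt (κ * R))) ^ 4 / R ^ 2) ∧
    ∃ β : ℝ → ℝ, ContDiff ℝ 1 β ∧ β 0 = Real.arcsin (Real.sqrt (κ * R)) ∧
      (∀ s : ℝ, (deriv β s) ^ 2 = κ ^ 2 - Real.sin (β s) ^ 4 / R ^ 2) ∧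
      ∃ s t : ℝ, β s ≠ β t := by
  have hq0 : 0 < √(κ * R) := Real.sqrt_pos.2 (mul_pos hκ hR)
  have hq2 : √(κ * R) ^ 2 = κ * R := Real.sq_sqrt (mul_pos hκ hR).le
  have hq1 : √(κ * R) < 1 := by
    rw [Real.sqrt_lt' one_pos, one_pow]
    exact (lt_div_iff₀ hR).1 hκR
  have hRHS : ∀ y : ℝ, (√(κ * R) * y) ^ 4 / R ^ 2 = κ ^ 2 * y ^ 4 := fun y => by
    rw [mul_pow, show √(κ * R) ^ 4 = (√(κ * R) ^ 2) ^ 2 by ring, hq2]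
    field_simp
  set q := √(κ * R)
  constructor
  · intro s
    rw [Real.sin_arcsin (by linarith) hq1.le, deriv_const]
    have := hRHS 1
    simp only [mul_one, one_pow] at this
    rw [this]
    ring
  have hsin : ∀ x : ℝ, (q * Real.sin x) ^ 2 < 1 := fun x => by
    have := Real.sin_sq_le_one x
    rw [mul_pow]
    nlinarith [sq_nonneg (Real.sin x)]
  -- Under `sin β = q sin φ` the equation becomes `φ' = F φ`, with `F` smooth and positive.
  obtain ⟨φ, hφ0, hφ, hφs⟩ := exists_surjective_hasDerivAt_of_pos_of_le
    (F := fun x => κ / q * (√(1 + Real.sin x ^ 2) * √(1 - (q * Real.sin x) ^ 2)))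
    (M := κ / q * (√2 * 1)) (by fun_prop)
    (fun x => mul_pos (div_pos hκ hq0) (mul_pos (Real.sqrt_pos.2 (by positivity))
      (Real.sqrt_pos.2 (sub_pos.2 (hsin x)))))
    (fun x => by
      have h₁ : √(1 + Real.sin x ^ 2) ≤ √2 :=
        Real.sqrt_le_sqrt (by linarith [Real.sin_sq_le_one x])
      have h₂ : √(1 - (q * Real.sin x) ^ 2) ≤ 1 :=
        Real.sqrt_le_one.2 (by linarith [sq_nonneg (q * Real.sin x)])
      gcongr)
    (Real.pi / 2)
  have hφc : Continuous φ := continuous_iff_continuousAt.2 fun t => (hφ t).continuousAt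
  have hβ : ∀ t, HasDerivAt (fun t => Real.arcsin (q * Real.sin (φ t)))
      (κ * Real.cos (φ t) * √(1 + Real.sin (φ t) ^ 2)) t := fun t => by
    have hlt := abs_lt.1 ((sq_lt_one_iff_abs_lt_one _).1 (hsin (φ t)))
    have h := (Real.hasDerivAt_arcsin hlt.1.ne' hlt.2.ne).comp t ((hφ t).sin.const_mul q)
    refine h.congr_deriv ?_
    have := (Real.sqrt_pos.2 (sub_pos.2 (hsin (φ t)))).ne'
    generalize √(1 - (q * Real.sin (φ t)) ^ 2) = w at this ⊢
    field_simp
  refine ⟨fun t => Real.arcsin (q * Real.sin (φ t)), ?_, ?_, fun s => ?_, ?_⟩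
  · refine contDiff_one_iff_deriv.2 ⟨fun t => (hβ t).differentiableAt, ?_⟩
    rw [funext fun t => (hβ t).deriv]
    fun_prop
  · simp [hφ0]
  · have hle := abs_le.1 ((sq_le_one_iff_abs_le_one _).1 (hsin (φ s)).le)
    rw [(hβ s).deriv, Real.sin_arcsin hle.1 hle.2, hRHS, mul_pow, mul_pow, Real.cos_sq',
      Real.sq_sqrt (by positivity)]
    ring
  · obtain ⟨t, ht⟩ := hφs 0
    refine ⟨0, t, ?_⟩
    simpa [hφ0, ht] using hq0.ne'
end

section
/- Let κ > 0 be a constant, let τ : ℝ → ℝ be continuous, and let c, e₁, e₂, e₃ : ℝ → ℝ³ be differentiable and satisfy c' = e₁ together with the Frenet–Serret equations e₁' = κ·e₂, e₂' = −κ·e₁ − τ·e₃, e₃' = τ·e₂, with (e₁(0), e₂(0), e₃(0)) orthonormal. Fix s₁ ∈ ℝ and suppose τ is skew symmetric about s₁, i.e. τ(2s₁ − s) = −τ(s) for all s. Let σ : ℝ³ → ℝ³ be the affine reflection in the normal plane at c(s₁), namely σ(x) = x − 2⟨x − c(s₁), e₁(s₁)⟩·e₁(s₁). Then c(2s₁ −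 s) = σ(c(s)) for all s ∈ ℝ; that is, the normal plane at c(s₁) is a symmetry plane of the curve. -/
open scoped RealInnerProductSpace

/-- `(u, v, w)` is an orthonormal triple in `ℝ³`. -/
def OrthoTriple (u v w : EuclideanSpace ℝ (Fin 3)) : Prop :=
  ‖u‖ = 1 ∧ ‖v‖ = 1 ∧ ‖w‖ = 1 ∧ ⟪u, v⟫ = 0 ∧ ⟪u, w⟫ = 0 ∧ ⟪v, w⟫ = 0

/-- `e₁, e₂, e₃` solve the Frenet–Serret system with curvature `κ` and torsion `τ`. -/
structure IsFrenetSolution {E : Type*} [NormedAddCommGroup E] [InnerProductSpace ℝ E]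
    (κ : ℝ) (τ : ℝ → ℝ) (e₁ e₂ e₃ : ℝ → E) : Prop where
  hasDerivAt_fst : ∀ s, HasDerivAt e₁ (κ • e₂ s) s
  hasDerivAt_snd : ∀ s, HasDerivAt e₂ (-(κ • e₁ s) - τ s • e₃ s) s
  hasDerivAt_trd : ∀ s, HasDerivAt e₃ (τ s • e₂ s) s

namespace IsFrenetSolution

variable {E : Type*} [NormedAddCommGroup E] [InnerProductSpace ℝ E]
  {κ : ℝ} {τ : ℝ → ℝ} {e₁ e₂ e₃ f₁ f₂ f₃ : ℝ → E}

theorem sub (he : IsFrenetSolution κ τ e₁ e₂ e₃) (hf : IsFrenetSolution κ τ f₁ f₂ f₃) :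
    IsFrenetSolution κ τ (fun s => e₁ s - f₁ s) (fun s => e₂ s - f₂ s)
      (fun s => e₃ s - f₃ s) where
  hasDerivAt_fst s := ((he.hasDerivAt_fst s).sub (hf.hasDerivAt_fst s)).congr_deriv (by module)
  hasDerivAt_snd s := ((he.hasDerivAt_snd s).sub (hf.hasDerivAt_snd s)).congr_deriv (by module)
  hasDerivAt_trd s := ((he.hasDerivAt_trd s).sub (hf.hasDerivAt_trd s)).congr_deriv (by module)

theorem clm_comp (he : IsFrenetSolution κ τ e₁ e₂ e₃) (L : E →L[ℝ] E) :
    IsFrenetSolution κ τ (fun s => L (e₁ s)) (fun s => L (e₂ s)) (fun s => L (e₃ s)) where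
  hasDerivAt_fst s := (L.hasFDerivAt.comp_hasDerivAt s (he.hasDerivAt_fst s)).congr_deriv
    (by simp)
  hasDerivAt_snd s := (L.hasFDerivAt.comp_hasDerivAt s (he.hasDerivAt_snd s)).congr_deriv
    (by simp)
  hasDerivAt_trd s := (L.hasFDerivAt.comp_hasDerivAt s (he.hasDerivAt_trd s)).congr_deriv
    (by simp)

/-- Reversing the parameter about a point of skew symmetry of the torsion, and the sign of the
first vector, gives another solution. -/
theorem reverse (he : IsFrenetSolution κ τ e₁ e₂ e₃) {s₁ : ℝ}
    (hskew : ∀ s, τ (2 * s₁ - s) = -τ s) :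
    IsFrenetSolution κ τ (fun s => -e₁ (2 * s₁ - s)) (fun s => e₂ (2 * s₁ - s))
      (fun s => e₃ (2 * s₁ - s)) where
  hasDerivAt_fst s := ((he.hasDerivAt_fst _).comp_const_sub (2 * s₁) s).neg.congr_deriv
    (by module)
  hasDerivAt_snd s := ((he.hasDerivAt_snd _).comp_const_sub (2 * s₁) s).congr_deriv
    (by rw [hskew]; module)
  hasDerivAt_trd s := ((he.hasDerivAt_trd _).comp_const_sub (2 * s₁) s).congr_deriv
    (by rw [hskew]; module)

theorem eq_zero (he : IsFrenetSolution κ τ e₁ e₂ e₃) {t : ℝ} (h₁ : e₁ t = 0) (h₂ : e₂ t = 0)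
    (h₃ : e₃ t = 0) (s : ℝ) : e₁ s = 0 ∧ e₂ s = 0 ∧ e₃ s = 0 := by
  have hd : ∀ s, HasDerivAt (fun s => ‖e₁ s‖ ^ 2 + ‖e₂ s‖ ^ 2 + ‖e₃ s‖ ^ 2) 0 s := fun s =>
    (((he.hasDerivAt_fst s).norm_sq.add (he.hasDerivAt_snd s).norm_sq).add
      (he.hasDerivAt_trd s).norm_sq).congr_deriv (by
        simp only [inner_sub_right, inner_neg_right, inner_smul_right,
          real_inner_comm (e₁ s) (e₂ s), real_inner_comm (e₂ s) (e₃ s)]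
        ring)
  have h := is_const_of_deriv_eq_zero (fun s => (hd s).differentiableAt)
    (fun s => (hd s).deriv) s t
  simp only [h₁, h₂, h₃, norm_zero] at h
  refine ⟨?_, ?_, ?_⟩ <;> rw [← norm_eq_zero, ← sq_eq_zero_iff] <;>
    nlinarith [sq_nonneg ‖e₁ s‖, sq_nonneg ‖e₂ s‖, sq_nonneg ‖e₃ s‖]

/-- If a solution is orthonormal at one parameter value, its first vector remains a unit vector
orthogonal to the other two. The squared
Frobenius norm of the Gram matrix minus the identity is a conserved quantity. -/
theorem inner_fst_of_orthonormal (he : IsFrenetSolution κ τ e₁ e₂ e₃) {t : ℝ}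
    (h₁₁ : ⟪e₁ t, e₁ t⟫ = 1) (h₂₂ : ⟪e₂ t, e₂ t⟫ = 1) (h₃₃ : ⟪e₃ t, e₃ t⟫ = 1)
    (h₁₂ : ⟪e₁ t, e₂ t⟫ = 0) (h₁₃ : ⟪e₁ t, e₃ t⟫ = 0) (h₂₃ : ⟪e₂ t, e₃ t⟫ = 0) (s : ℝ) :
    ⟪e₁ s, e₁ s⟫ = 1 ∧ ⟪e₁ s, e₂ s⟫ = 0 ∧ ⟪e₁ s, e₃ s⟫ = 0 := by
  have hd : ∀ s, HasDerivAt (fun s => (⟪e₁ s, e₁ s⟫ - 1) ^ 2 + (⟪e₂ s, e₂ s⟫ - 1) ^ 2 +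
      (⟪e₃ s, e₃ s⟫ - 1) ^ 2 + 2 * ⟪e₁ s, e₂ s⟫ ^ 2 + 2 * ⟪e₁ s, e₃ s⟫ ^ 2 +
      2 * ⟪e₂ s, e₃ s⟫ ^ 2) 0 s := fun s => by
    have d₁ := he.hasDerivAt_fst s
    have d₂ := he.hasDerivAt_snd s
    have d₃ := he.hasDerivAt_trd s
    refine (((((((d₁.inner ℝ d₁).sub_const 1).pow 2).add
      (((d₂.inner ℝ d₂).sub_const 1).pow 2)).add
      (((d₃.inner ℝ d₃).sub_const 1).pow 2)).add
      (((d₁.inner ℝ d₂).pow 2).const_mul 2)).add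
      (((d₁.inner ℝ d₃).pow 2).const_mul 2)).add
      (((d₂.inner ℝ d₃).pow 2).const_mul 2) |>.congr_deriv ?_
    simp only [inner_sub_right, inner_neg_right, inner_smul_right, inner_sub_left,
      inner_neg_left, real_inner_smul_left, real_inner_comm (e₁ s) (e₂ s),
      real_inner_comm (e₂ s) (e₃ s)]
    push_cast
    ring
  have h := is_const_of_deriv_eq_zero (fun s => (hd s).differentiableAt)
    (fun s => (hd s).deriv) s t
  simp only [h₁₁, h₂₂, h₃₃, h₁₂, h₁₃, h₂₃] at h
  have p₁ := sq_nonneg (⟪e₁ s, e₁ s⟫ - 1)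
  have p₂ := sq_nonneg (⟪e₂ s, e₂ s⟫ - 1)
  have p₃ := sq_nonneg (⟪e₃ s, e₃ s⟫ - 1)
  have p₄ := sq_nonneg ⟪e₁ s, e₂ s⟫
  have p₅ := sq_nonneg ⟪e₁ s, e₃ s⟫
  have p₆ := sq_nonneg ⟪e₂ s, e₃ s⟫
  refine ⟨?_, ?_, ?_⟩
  · rw [← sub_eq_zero, ← sq_eq_zero_iff]
    linarith
  · rw [← sq_eq_zero_iff]
    linarith
  · rw [← sq_eq_zero_iff]
    linarith

/-- The tangent at the mirrored parameter is minus the reflected tangent. -/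
theorem fst_reverse (he : IsFrenetSolution κ τ e₁ e₂ e₃) {s₁ : ℝ}
    (hskew : ∀ s, τ (2 * s₁ - s) = -τ s) (h₁₁ : ⟪e₁ s₁, e₁ s₁⟫ = 1)
    (h₁₂ : ⟪e₁ s₁, e₂ s₁⟫ = 0) (h₁₃ : ⟪e₁ s₁, e₃ s₁⟫ = 0) (s : ℝ) :
    -e₁ (2 * s₁ - s) = e₁ s - (2 * ⟪e₁ s, e₁ s₁⟫) • e₁ s₁ := by
  let L : E →L[ℝ] E := ContinuousLinearMap.id ℝ E -
    (2 : ℝ) • (innerSL ℝ (e₁ s₁)).smulRight (e₁ s₁)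
  have hL : ∀ v, L v = v - (2 * ⟪e₁ s₁, v⟫) • e₁ s₁ := fun v => by simp [L, smul_smul]
  have hr : 2 * s₁ - s₁ = s₁ := by ring
  have h := (((he.reverse hskew).sub (he.clm_comp L)).eq_zero (t := s₁)
    (by rw [hL, hr, h₁₁]; module) (by rw [hL, hr, h₁₂]; module)
    (by rw [hL, hr, h₁₃]; module) s).1
  rw [sub_eq_zero.1 h, hL, real_inner_comm]

end IsFrenetSolution

/-- If the torsion of a constant curvature space curve is skew symmetric about
`s₁`, i.e. `τ(2s₁ − s) = −τ(s)`, then the normal plane at `c(s₁)` is a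
symmetry plane of the curve: `c(2s₁ − s) = σ(c(s))` where `σ` is the affine
reflection `σ(x) = x − 2⟨x − c(s₁), e₁(s₁)⟩·e₁(s₁)` in that plane. -/
theorem normal_plane_symmetry (κ : ℝ) (hκ : 0 < κ) (τ : ℝ → ℝ)
    (hτ : Continuous τ)
    (c e₁ e₂ e₃ : ℝ → EuclideanSpace ℝ (Fin 3))
    (hc : Differentiable ℝ c) (he₁ : Differentiable ℝ e₁)
    (he₂ : Differentiable ℝ e₂) (he₃ : Differentiable ℝ e₃)
    (hc' : ∀ s : ℝ, deriv c s = e₁ s)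
    (hf₁ : ∀ s : ℝ, deriv e₁ s = κ • e₂ s)
    (hf₂ : ∀ s : ℝ, deriv e₂ s = -(κ • e₁ s) - τ s • e₃ s)
    (hf₃ : ∀ s : ℝ, deriv e₃ s = τ s • e₂ s)
    (h0 : OrthoTriple (e₁ 0) (e₂ 0) (e₃ 0))
    (s₁ : ℝ) (hskew : ∀ s : ℝ, τ (2 * s₁ - s) = -τ s) :
    ∀ s : ℝ, c (2 * s₁ - s) =
      c s - (2 * ⟪c s - c s₁, e₁ s₁⟫) • e₁ s₁ := by
  have he : IsFrenetSolution κ τ e₁ e₂ e₃ :=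
    ⟨fun s => hf₁ s ▸ (he₁ s).hasDerivAt, fun s => hf₂ s ▸ (he₂ s).hasDerivAt,
      fun s => hf₃ s ▸ (he₃ s).hasDerivAt⟩
  have hcd : ∀ s, HasDerivAt c (e₁ s) s := fun s => hc' s ▸ (hc s).hasDerivAt
  obtain ⟨n₁, n₂, n₃, h₁₂, h₁₃, h₂₃⟩ := h0
  obtain ⟨k₁₁, k₁₂, k₁₃⟩ := he.inner_fst_of_orthonormal (t := 0) (by simp [n₁]) (by simp [n₂])
    (by simp [n₃]) h₁₂ h₁₃ h₂₃ s₁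
  have hd : ∀ s, HasDerivAt
      (fun s => c (2 * s₁ - s) - (c s - (2 * ⟪c s - c s₁, e₁ s₁⟫) • e₁ s₁)) 0 s := fun s => by
    have d := (((hcd s).sub_const (c s₁)).inner ℝ (hasDerivAt_const s (e₁ s₁))).const_mul 2
    refine (((hcd _).comp_const_sub (2 * s₁) s).sub
      ((hcd s).sub (d.smul_const (e₁ s₁)))).congr_deriv ?_
    rw [he.fst_reverse hskew k₁₁ k₁₂ k₁₃ s, inner_zero_right, zero_add, sub_self]
  intro s
  have h := is_const_of_deriv_eq_zero (fun s => (hd s).differentiableAt)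
    (fun s => (hd s).deriv) s s₁
  have hr : 2 * s₁ - s₁ = s₁ := by ring
  simpa [hr, sub_eq_zero] using h
end

section
/- Let κ > 0 be constant, let τ₁, τ₂ : ℝ → ℝ be continuous, and for i = 1, 2 let (cᵢ, e₁ᵢ, e₂ᵢ, e₃ᵢ) be differentiable solutions of the Frenet–Serret system cᵢ' = e₁ᵢ, e₁ᵢ' = κ·e₂ᵢ, e₂ᵢ' = −κ·e₁ᵢ − τᵢ·e₃ᵢ, e₃ᵢ' = τᵢ·e₂ᵢ on ℝ. If τ₁ = τ₂, c₁(0) = c₂(0), e₁₁(0) = e₁₂(0), e₂₁(0) = e₂₂(0) and e₃₁(0) = e₃₂(0), then c₁(s) = c₂(s) for all s ∈ ℝ; that is, the Frenet–Serret equations determine the space curve uniquely from the initial point and initial frame. -/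
/-- The Frenet–Serret frame equations have a skew-symmetric coefficient matrix, so the sum of the
squared norms of the three frame vectors is constant; in particular a solution that vanishes at `0`
vanishes identically. -/
theorem frenet_serret_frame_eq_zero {E : Type*} [NormedAddCommGroup E] [InnerProductSpace ℝ E]
    {κ τ : ℝ → ℝ} {u v w : ℝ → E}
    (hu : ∀ s, HasDerivAt u (κ s • v s) s)
    (hv : ∀ s, HasDerivAt v (-(κ s • u s) - τ s • w s) s)
    (hw : ∀ s, HasDerivAt w (τ s • v s) s)
    (hu0 : u 0 = 0) (hv0 : v 0 = 0) (hw0 : w 0 = 0) (s : ℝ) :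
    u s = 0 ∧ v s = 0 ∧ w s = 0 := by
  have hderiv (t : ℝ) : HasDerivAt (fun x => ‖u x‖ ^ 2 + ‖v x‖ ^ 2 + ‖w x‖ ^ 2) 0 t := by
    refine (((hu t).norm_sq.add (hv t).norm_sq).add (hw t).norm_sq).congr_deriv ?_
    simp only [inner_sub_right, inner_neg_right, real_inner_smul_right,
      real_inner_comm (u t) (v t), real_inner_comm (v t) (w t)]
    ring
  have hconst := is_const_of_deriv_eq_zero (fun t => (hderiv t).differentiableAt)
    (fun t => (hderiv t).deriv) s 0
  simp only [hu0, hv0, hw0, norm_zero] at hconst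
  refine ⟨?_, ?_, ?_⟩ <;> rw [← norm_eq_zero, ← sq_eq_zero_iff] <;>
    nlinarith [sq_nonneg ‖u s‖, sq_nonneg ‖v s‖, sq_nonneg ‖w s‖]

/-- The Frenet–Serret equations determine the space curve uniquely from the
initial point and initial frame: two solutions of the Frenet–Serret system
with the same constant curvature `κ`, the same torsion function, the same
initial point and the same initial frame coincide. -/
theorem frenet_serret_uniqueness (κ : ℝ) (hκ : 0 < κ)
    (τ₁ τ₂ : ℝ → ℝ) (hτ₁ : Continuous τ₁) (hτ₂ : Continuous τ₂)
    (c₁ e₁₁ e₂₁ e₃₁ c₂ e₁₂ e₂₂ e₃₂ : ℝ → EuclideanSpace ℝ (Fin 3))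
    (hc₁ : Differentiable ℝ c₁) (he₁₁ : Differentiable ℝ e₁₁)
    (he₂₁ : Differentiable ℝ e₂₁) (he₃₁ : Differentiable ℝ e₃₁)
    (hc₂ : Differentiable ℝ c₂) (he₁₂ : Differentiable ℝ e₁₂)
    (he₂₂ : Differentiable ℝ e₂₂) (he₃₂ : Differentiable ℝ e₃₂)
    (hc₁' : ∀ s : ℝ, deriv c₁ s = e₁₁ s)
    (hf₁₁ : ∀ s : ℝ, deriv e₁₁ s = κ • e₂₁ s)
    (hf₂₁ : ∀ s : ℝ, deriv e₂₁ s = -(κ • e₁₁ s) - τ₁ s • e₃₁ s)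
    (hf₃₁ : ∀ s : ℝ, deriv e₃₁ s = τ₁ s • e₂₁ s)
    (hc₂' : ∀ s : ℝ, deriv c₂ s = e₁₂ s)
    (hf₁₂ : ∀ s : ℝ, deriv e₁₂ s = κ • e₂₂ s)
    (hf₂₂ : ∀ s : ℝ, deriv e₂₂ s = -(κ • e₁₂ s) - τ₂ s • e₃₂ s)
    (hf₃₂ : ∀ s : ℝ, deriv e₃₂ s = τ₂ s • e₂₂ s)
    (hττ : τ₁ = τ₂)
    (hc0 : c₁ 0 = c₂ 0) (he₁0 : e₁₁ 0 = e₁₂ 0)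
    (he₂0 : e₂₁ 0 = e₂₂ 0) (he₃0 : e₃₁ 0 = e₃₂ 0) :
    ∀ s : ℝ, c₁ s = c₂ s := by
  subst hττ
  have frame (t : ℝ) : e₁₁ t - e₁₂ t = 0 := by
    refine (frenet_serret_frame_eq_zero (κ := fun _ => κ) (τ := τ₁)
      (u := fun x => e₁₁ x - e₁₂ x) (v := fun x => e₂₁ x - e₂₂ x) (w := fun x => e₃₁ x - e₃₂ x)
      (fun x => ?_) (fun x => ?_) (fun x => ?_)
      (sub_eq_zero.2 he₁0) (sub_eq_zero.2 he₂0) (sub_eq_zero.2 he₃0) t).1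
    · refine ((he₁₁ x).hasDerivAt.sub (he₁₂ x).hasDerivAt).congr_deriv ?_
      rw [hf₁₁, hf₁₂, smul_sub]
    · refine ((he₂₁ x).hasDerivAt.sub (he₂₂ x).hasDerivAt).congr_deriv ?_
      rw [hf₂₁, hf₂₂]
      module
    · refine ((he₃₁ x).hasDerivAt.sub (he₃₂ x).hasDerivAt).congr_deriv ?_
      rw [hf₃₁, hf₃₂, smul_sub]
  intro s
  have hconst := is_const_of_deriv_eq_zero (f := fun x => c₁ x - c₂ x) (hc₁.sub hc₂)
    (fun x => by rw [deriv_fun_sub (hc₁ x) (hc₂ x), hc₁', hc₂', frame]) s 0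
  simpa [hc0, sub_eq_zero] using hconst
end
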